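/- arXiv:2401.00588 — 4 statements merged into one kernel-verified Lean document; each statement's English description precedes it below -/
import Mathlib

section
/- In the VTC algorithm, during any time interval throughout which the set Q of backlogged clients remains nonempty, the minimum counter min_{i∈Q} c_i is non-decreasing; that is, each transition of the algorithm (arrival of a new backlogged client, departure of a client, prefill scheduling, decode charging) maps min_{i∈Q} c_i to a value at least as large as before the transition. -/
/-!
A formal model of the Virtual Token Counter (VTC) scheduler.

There is a finite set of clients and fixed positive constants: `wp` and `wq`,
the per-token costs of input and output tokens; `Linput`, the maximum number of
input tokens of any single request; `M`, the maximum number of tokens the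
server can hold in memory at once.  The scheduler maintains a real-valued
virtual counter `c i` for each client `i` and a set `Q` of backlogged clients.
The state additionally records `lastMin`, the value of `min_{i∈Q} c i` at the
last instant `Q` was nonempty; `schedC i`, the counter value of client `i` at
the time its most recently scheduled request was scheduled (a time at which
`c i = min_{j∈Q} c j` held); and `w i`, the cumulative service received by
client `i` (`wp` per processed input token plus `wq` per generated output
token).
-/

/-- Fixed positive parameters of the VTC model. -/
structure VTCParams where
  wp : ℝ
  wq : ℝ
  Linput : ℝ
  M : ℝ
  wp_pos : 0 < wp
  wq_pos : 0 < wq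
  Linput_pos : 0 < Linput
  M_pos : 0 < M

/-- The scheduler state. -/
structure VTCState (C : Type*) where
  /-- virtual counters -/
  c : C → ℝ
  /-- set of backlogged clients -/
  Q : Finset C
  /-- the value of `min_{i∈Q} c i` at the last instant `Q` was nonempty -/
  lastMin : ℝ
  /-- counter value of each client at the time of its most recent prefill scheduling -/
  schedC : C → ℝ
  /-- cumulative service received by each client -/
  w : C → ℝ

namespace VTCState

variable {C : Type*}

/-- The minimum counter over backlogged clients (its last nonempty value if `Q = ∅`). -/
noncomputable def minQ (s : VTCState C) : ℝ :=
  if h : s.Q.Nonempty then s.Q.inf' h s.c else s.lastMin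

/-- Build the successor state from new counters, backlog set, schedule record and
service record, maintaining the `lastMin` field. -/
noncomputable def next (s : VTCState C) (c' : C → ℝ) (Q' : Finset C) (sc' w' : C → ℝ) :
    VTCState C :=
  { c := c', Q := Q', schedC := sc', w := w',
    lastMin := if h : Q'.Nonempty then Q'.inf' h c' else s.minQ }

end VTCState

/-- The transitions of the VTC scheduler.

(Arrival) a client `u` not in `Q` becomes backlogged: `Q` becomes `Q ∪ {u}` and
`c u` is replaced by `max (c u) (min_{i∈Q} c i)` (using the last nonempty value
of the minimum if `Q` was empty).

(Departure) a client with no waiting or running requests leaves `Q`; counters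
are unchanged.

(Prefill) a waiting request of input length `0 < l ≤ Linput` of a client `k`
attaining the minimum counter among backlogged clients is scheduled and `c k`
increases by `wp * l` (which is also service delivered to `k`); the counter
value of `k` at scheduling time is recorded.

(Decode) the counter of a client `k` with running requests increases by `wq`
per newly generated output token (here one token per step, which is also
service delivered to `k`); since at most `M` tokens fit in memory, the total
decode charge to `k` since the time its most recently scheduled request was
scheduled is at most `wq * M`. -/
inductive VTCStep {C : Type*} [DecidableEq C] (p : VTCParams) :
    VTCState C → VTCState C → Prop
  | arrival (s : VTCState C) (u : C) (hu : u ∉ s.Q) :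
      VTCStep p s (s.next (Function.update s.c u (max (s.c u) s.minQ))
        (insert u s.Q) s.schedC s.w)
  | departure (s : VTCState C) (u : C) (hu : u ∈ s.Q) :
      VTCStep p s (s.next s.c (s.Q.erase u) s.schedC s.w)
  | prefill (s : VTCState C) (k : C) (l : ℝ) (hk : k ∈ s.Q)
      (hmin : ∀ i ∈ s.Q, s.c k ≤ s.c i) (hl0 : 0 < l) (hlL : l ≤ p.Linput) :
      VTCStep p s (s.next (Function.update s.c k (s.c k + p.wp * l)) s.Q
        (Function.update s.schedC k (s.c k))
        (Function.update s.w k (s.w k + p.wp * l)))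
  | decode (s : VTCState C) (k : C) (hk : k ∈ s.Q)
      (hmem : s.c k + p.wq ≤ s.schedC k + p.wq * p.M) :
      VTCStep p s (s.next (Function.update s.c k (s.c k + p.wq)) s.Q s.schedC
        (Function.update s.w k (s.w k + p.wq)))

/-- The initial state: all counters zero, no backlogged clients. -/
def VTCInit (C : Type*) : VTCState C :=
  { c := fun _ => 0, Q := ∅, lastMin := 0, schedC := fun _ => 0, w := fun _ => 0 }

/-- A state is reachable if it can be obtained from the initial state by a
finite sequence of VTC transitions. -/
def VTCReachable {C : Type*} [DecidableEq C] (p : VTCParams) (s : VTCState C) : Prop :=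
  Relation.ReflTransGen (VTCStep p) (VTCInit C) s

/-- An execution trace of the VTC scheduler, indexed by discrete time
(stuttering allowed). -/
def VTCTraj {C : Type*} [DecidableEq C] (p : VTCParams) (traj : ℕ → VTCState C) : Prop :=
  traj 0 = VTCInit C ∧ ∀ n, VTCStep p (traj n) (traj (n + 1)) ∨ traj (n + 1) = traj n

/-- In the VTC algorithm, during any time interval throughout
which the set `Q` of backlogged clients remains nonempty, the minimum counter
`min_{i∈Q} c i` is non-decreasing: each transition of the algorithm (arrival of
a new backlogged client, departure of a client, prefill scheduling, decode
charging) maps `min_{i∈Q} c i` to a value at least as large as before the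
transition. -/
theorem vtc_min_counter_nondecreasing {C : Type*} [DecidableEq C] (p : VTCParams)
    (s s' : VTCState C) (hstep : VTCStep p s s')
    (hQ : s.Q.Nonempty) (hQ' : s'.Q.Nonempty) :
    s.Q.inf' hQ s.c ≤ s'.Q.inf' hQ' s'.c := by
  refine Finset.le_inf' _ _ fun i hi => ?_
  have hmono {k : C} {a : ℝ} (hi : i ∈ s.Q) (ha : 0 ≤ a) :
      s.Q.inf' hQ s.c ≤ Function.update s.c k (s.c k + a) i :=
    (Finset.inf'_le s.c hi).trans
      (le_update_self_iff.mpr (le_add_of_nonneg_right ha) i)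
  cases hstep with
  | arrival u hu =>
    simp only [VTCState.next, VTCState.minQ, dif_pos hQ] at hi ⊢
    rcases eq_or_ne i u with rfl | hne
    · simp
    · rw [Function.update_of_ne hne]
      exact Finset.inf'_le s.c (Finset.mem_of_mem_insert_of_ne hi hne)
  | departure u hu => exact Finset.inf'_le s.c (Finset.mem_of_mem_erase hi)
  | prefill k l hk hmin hl0 hlL => exact hmono hi (mul_pos p.wp_pos hl0).le
  | decode k hk hmem => exact hmono hi p.wq_pos.le
end

section
/- In the VTC algorithm, at every time at which the set Q of backlogged clients is nonempty, max_{i∈Q} c_i − min_{i∈Q} c_i ≤ max(w_p·L_input, w_q·M); that is, this invariant holds initially (all counters zero) and is preserved by every transition of the algorithm. -/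
namespace VTCState

variable {C : Type*}

theorem minQ_of_nonempty {s : VTCState C} (h : s.Q.Nonempty) : s.minQ = s.Q.inf' h s.c :=
  dif_pos h

theorem minQ_le {s : VTCState C} {i : C} (hi : i ∈ s.Q) : s.minQ ≤ s.c i := by
  rw [minQ_of_nonempty ⟨i, hi⟩]
  exact Finset.inf'_le _ hi

theorem le_minQ_next {s : VTCState C} {c' : C → ℝ} {Q' : Finset C} {sc' w' : C → ℝ}
    (h : ∀ i ∈ Q', s.minQ ≤ c' i) : s.minQ ≤ (s.next c' Q' sc' w').minQ := by
  by_cases hQ : Q'.Nonempty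
  · rw [minQ_of_nonempty (s := s.next c' Q' sc' w') hQ]
    exact Finset.le_inf' _ _ h
  · simp [minQ, next, hQ]

/-- Every counter, of a backlogged client or not, exceeds the current minimum by at most `B`, and
no recorded scheduling value exceeds that minimum. -/
structure Balanced (B : ℝ) (s : VTCState C) : Prop where
  c_le : ∀ i, s.c i ≤ s.minQ + B
  schedC_le : ∀ i, s.schedC i ≤ s.minQ

theorem Balanced.next {B : ℝ} {s : VTCState C} {c' : C → ℝ} {Q' : Finset C} {sc' w' : C → ℝ}
    (hQ : ∀ i ∈ Q', s.minQ ≤ c' i) (hc : ∀ i, c' i ≤ s.minQ + B) (hsc : ∀ i, sc' i ≤ s.minQ) :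
    (s.next c' Q' sc' w').Balanced B := by
  have hmono := le_minQ_next (sc' := sc') (w' := w') hQ
  exact ⟨fun i => (hc i).trans (by gcongr), fun i => (hsc i).trans hmono⟩

theorem balanced_init {B : ℝ} (hB : 0 ≤ B) : (VTCInit C).Balanced B := by
  constructor <;> simp [VTCInit, minQ, hB]

theorem Balanced.step [DecidableEq C] {p : VTCParams} {B : ℝ} {s t : VTCState C}
    (hp : p.wp * p.Linput ≤ B) (hq : p.wq * p.M ≤ B) (hs : s.Balanced B) (hst : VTCStep p s t) :
    t.Balanced B := by
  have hB : 0 ≤ B := (mul_pos p.wp_pos p.Linput_pos).le.trans hp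
  cases hst with
  | arrival u hu =>
    refine Balanced.next (fun i hi => ?_) (fun i => ?_) hs.schedC_le
    · obtain rfl | hne := eq_or_ne i u
      · simp
      · simpa [hne] using minQ_le (Finset.mem_of_mem_insert_of_ne hi hne)
    · obtain rfl | hne := eq_or_ne i u
      · simpa [hB] using hs.c_le i
      · simpa [hne] using hs.c_le i
  | departure u hu =>
    exact Balanced.next (fun i hi => minQ_le (Finset.mem_of_mem_erase hi)) hs.c_le hs.schedC_le
  | prefill k l hk hmin hl0 hlL =>
    have hck : s.c k = s.minQ := by
      refine le_antisymm ?_ (minQ_le hk)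
      rw [minQ_of_nonempty ⟨k, hk⟩]
      exact Finset.le_inf' _ _ hmin
    have hpos := mul_pos p.wp_pos hl0
    have hle := mul_le_mul_of_nonneg_left hlL p.wp_pos.le
    refine Balanced.next (fun i hi => ?_) (fun i => ?_) (fun i => ?_)
    all_goals obtain rfl | hne := eq_or_ne i k
    · simp only [Function.update_self]; linarith
    · simpa [hne] using minQ_le hi
    · simp only [Function.update_self]; linarith
    · simpa [hne] using hs.c_le i
    · simpa using hck.le
    · simpa [hne] using hs.schedC_le i
  | decode k hk hmem =>
    have hpos := p.wq_pos
    refine Balanced.next (fun i hi => ?_) (fun i => ?_) hs.schedC_le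
    all_goals obtain rfl | hne := eq_or_ne i k
    · simp only [Function.update_self]; linarith [minQ_le hi]
    · simpa [hne] using minQ_le hi
    · simp only [Function.update_self]; linarith [hs.schedC_le i]
    · simpa [hne] using hs.c_le i

end VTCState

theorem VTCReachable.balanced {C : Type*} [DecidableEq C] {p : VTCParams} {s : VTCState C}
    (hs : VTCReachable p s) : s.Balanced (max (p.wp * p.Linput) (p.wq * p.M)) := by
  induction hs with
  | refl =>
    exact VTCState.balanced_init (le_max_of_le_left (mul_pos p.wp_pos p.Linput_pos).le)
  | tail _ hst ih => exact ih.step (le_max_left _ _) (le_max_right _ _) hst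

/-- In the VTC algorithm, at every time at which the set `Q`
of backlogged clients is nonempty,
`max_{i∈Q} c i − min_{i∈Q} c i ≤ max (wp·Linput) (wq·M)`;
that is, this invariant holds initially (all counters zero) and is preserved by
every transition of the algorithm — equivalently, it holds in every reachable
state. -/
theorem vtc_counter_invariant {C : Type*} [DecidableEq C] (p : VTCParams)
    (s : VTCState C) (hreach : VTCReachable p s) (hQ : s.Q.Nonempty) :
    s.Q.sup' hQ s.c - s.Q.inf' hQ s.c ≤ max (p.wp * p.Linput) (p.wq * p.M) := by
  rw [← VTCState.minQ_of_nonempty hQ, sub_le_iff_le_add']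
  exact Finset.sup'_le _ _ fun i _ => hreach.balanced.c_le i
end

section
/- Main fairness theorem for VTC: fix times t1 < t2 and two clients f and g that are both continuously backlogged during [t1, t2). Under the VTC algorithm, the difference in service received satisfies |W_f(t1,t2) − W_g(t1,t2)| ≤ 2·max(w_p·L_input, w_q·M). -/
namespace VTCState

variable {C : Type*}

theorem le_minQ {s : VTCState C} (hs : s.Q.Nonempty) {a : ℝ} (h : ∀ i ∈ s.Q, a ≤ s.c i) :
    a ≤ s.minQ := by
  unfold minQ
  rw [dif_pos hs]
  exact Finset.le_inf' _ _ h

theorem minQ_le_minQ_next (s : VTCState C) {c' : C → ℝ} {Q' : Finset C} (sc' w' : C → ℝ)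
    (h : ∀ i ∈ Q', s.minQ ≤ c' i) : s.minQ ≤ (s.next c' Q' sc' w').minQ := by
  by_cases hQ : Q'.Nonempty
  · exact le_minQ (s := s.next c' Q' sc' w') hQ h
  · simp [minQ, next, hQ]

/-- Counters exceed the minimum backlogged counter by at most the fairness bound, and every
recorded scheduling value is below that minimum. -/
structure IsBalanced (p : VTCParams) (s : VTCState C) : Prop where
  c_le : ∀ i, s.c i ≤ s.minQ + max (p.wp * p.Linput) (p.wq * p.M)
  schedC_le : ∀ i, s.schedC i ≤ s.minQ

theorem IsBalanced.abs_sub_le {p : VTCParams} {s : VTCState C} (hs : s.IsBalanced p) {f g : C}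
    (hf : f ∈ s.Q) (hg : g ∈ s.Q) :
    |s.c f - s.c g| ≤ max (p.wp * p.Linput) (p.wq * p.M) := by
  have h₁ := minQ_le hf
  have h₂ := minQ_le hg
  have h₃ := hs.c_le f
  have h₄ := hs.c_le g
  rw [abs_sub_le_iff]
  constructor <;> linarith

end VTCState

section VTCExecution

variable {C : Type*} [DecidableEq C] {p : VTCParams}

theorem VTCParams.fairnessBound_nonneg (p : VTCParams) :
    0 ≤ max (p.wp * p.Linput) (p.wq * p.M) :=
  le_max_of_le_left (mul_pos p.wp_pos p.Linput_pos).le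

theorem VTCStep.minQ_le {s t : VTCState C} (h : VTCStep p s t) : s.minQ ≤ t.minQ := by
  cases h with
  | arrival u hu =>
    refine s.minQ_le_minQ_next _ _ fun i hi => ?_
    rcases eq_or_ne i u with rfl | hne
    · simp
    · simpa [hne] using VTCState.minQ_le (Finset.mem_of_mem_insert_of_ne hi hne)
  | departure u hu =>
    exact s.minQ_le_minQ_next _ _ fun i hi => VTCState.minQ_le (Finset.mem_of_mem_erase hi)
  | prefill k l hk hmin hl0 hlL =>
    refine s.minQ_le_minQ_next _ _ fun i hi => (VTCState.minQ_le hi).trans ?_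
    have := mul_pos p.wp_pos hl0
    rcases eq_or_ne i k with rfl | hne <;> simp [*, this.le]
  | decode k hk hmem =>
    refine s.minQ_le_minQ_next _ _ fun i hi => (VTCState.minQ_le hi).trans ?_
    rcases eq_or_ne i k with rfl | hne <;> simp [*, p.wq_pos.le]

theorem VTCStep.isBalanced {s t : VTCState C} (h : VTCStep p s t) (hs : s.IsBalanced p) :
    t.IsBalanced p := by
  have hmono := h.minQ_le
  have hB := p.fairnessBound_nonneg
  suffices (∀ i, t.c i ≤ s.minQ + max (p.wp * p.Linput) (p.wq * p.M)) ∧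
      ∀ i, t.schedC i ≤ s.minQ from
    ⟨fun i => (this.1 i).trans (by gcongr), fun i => (this.2 i).trans hmono⟩
  clear hmono
  cases h with
  | arrival u hu =>
    refine ⟨fun i => ?_, hs.schedC_le⟩
    rcases eq_or_ne i u with rfl | hne
    · simpa [VTCState.next, -le_sup_iff, hB] using hs.c_le i
    · simpa [VTCState.next, hne, -le_sup_iff] using hs.c_le i
  | departure u hu => exact ⟨hs.c_le, hs.schedC_le⟩
  | prefill k l hk hmin hl0 hlL =>
    have hck : s.c k ≤ s.minQ := VTCState.le_minQ ⟨k, hk⟩ hmin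
    refine ⟨fun i => ?_, fun i => ?_⟩ <;> rcases eq_or_ne i k with rfl | hne
    · have hl : p.wp * l ≤ p.wp * p.Linput := mul_le_mul_of_nonneg_left hlL p.wp_pos.le
      simpa [VTCState.next] using add_le_add hck (hl.trans (le_max_left _ (p.wq * p.M)))
    · simpa [VTCState.next, hne] using hs.c_le i
    · simpa [VTCState.next] using hck
    · simpa [VTCState.next, hne] using hs.schedC_le i
  | decode k hk hmem =>
    refine ⟨fun i => ?_, hs.schedC_le⟩
    rcases eq_or_ne i k with rfl | hne
    · simpa [VTCState.next] using
        hmem.trans (add_le_add (hs.schedC_le i) (le_max_right (p.wp * p.Linput) _))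
    · simpa [VTCState.next, hne] using hs.c_le i

/-- The counter of a backlogged client increases exactly by the service it receives. -/
theorem VTCStep.w_sub_w {s t : VTCState C} (h : VTCStep p s t) {f : C} (hf : f ∈ s.Q) :
    t.w f - s.w f = t.c f - s.c f := by
  cases h with
  | arrival u hu =>
    have hne : f ≠ u := fun h => hu (h ▸ hf)
    simp [VTCState.next, hne]
  | departure u hu => simp [VTCState.next]
  | prefill k l => rcases eq_or_ne f k with rfl | hne <;> simp [VTCState.next, *]
  | decode k => rcases eq_or_ne f k with rfl | hne <;> simp [VTCState.next, *]

theorem VTCStep.c_eq_or_subset {s t : VTCState C} (h : VTCStep p s t) :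
    t.c = s.c ∨ s.Q ⊆ t.Q := by
  cases h with
  | arrival u => exact .inr (Finset.subset_insert _ _)
  | departure u => exact .inl rfl
  | prefill k => exact .inr subset_rfl
  | decode k => exact .inr subset_rfl

theorem VTCTraj.isBalanced {traj : ℕ → VTCState C} (h : VTCTraj p traj) (n : ℕ) :
    (traj n).IsBalanced p := by
  induction n with
  | zero =>
    rw [h.1]
    constructor <;> simp [VTCInit, VTCState.minQ, -le_sup_iff, p.fairnessBound_nonneg]
  | succ n ih =>
    rcases h.2 n with hstep | heq
    · exact hstep.isBalanced ih
    · rwa [heq]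

theorem VTCTraj.w_sub_w {traj : ℕ → VTCState C} (h : VTCTraj p traj) {t1 t2 : ℕ} (h12 : t1 ≤ t2)
    {f : C} (hf : ∀ m, t1 ≤ m → m < t2 → f ∈ (traj m).Q) :
    (traj t2).w f - (traj t1).w f = (traj t2).c f - (traj t1).c f := by
  induction t2, h12 using Nat.le_induction with
  | base => simp
  | succ n hn ih =>
    have ih := ih fun m hm hmn => hf m hm (hmn.trans n.lt_succ_self)
    rcases h.2 n with hstep | heq
    · linarith [hstep.w_sub_w (hf n hn n.lt_succ_self)]
    · rwa [heq]

theorem VTCTraj.abs_c_sub_c_succ_le {traj : ℕ → VTCState C} (h : VTCTraj p traj) {n : ℕ} {f g : C}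
    (hf : f ∈ (traj n).Q) (hg : g ∈ (traj n).Q) :
    |(traj (n + 1)).c f - (traj (n + 1)).c g| ≤ max (p.wp * p.Linput) (p.wq * p.M) := by
  have hn := (h.isBalanced n).abs_sub_le hf hg
  rcases h.2 n with hstep | heq
  · rcases hstep.c_eq_or_subset with hc | hQ
    · rwa [hc]
    · exact (h.isBalanced (n + 1)).abs_sub_le (hQ hf) (hQ hg)
  · rwa [heq]

end VTCExecution

/-- **main fairness theorem for VTC.** Fix times `t1 < t2` and
two clients `f` and `g` that are both continuously backlogged during
`[t1, t2)`.  Under the VTC algorithm, the difference in service received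
satisfies `|W_f(t1,t2) − W_g(t1,t2)| ≤ 2·max (wp·Linput) (wq·M)`, where the
service `W_f(t1,t2)` received by client `f` during `[t1,t2)` (namely `wp`
times the number of `f`'s input tokens processed plus `wq` times the number of
`f`'s output tokens generated during the interval) is `w f` at `t2` minus
`w f` at `t1`. -/
theorem vtc_main_fairness {C : Type*} [DecidableEq C] (p : VTCParams)
    (traj : ℕ → VTCState C) (htraj : VTCTraj p traj)
    (t1 t2 : ℕ) (h12 : t1 < t2) (f g : C)
    (hf : ∀ m, t1 ≤ m → m < t2 → f ∈ (traj m).Q)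
    (hg : ∀ m, t1 ≤ m → m < t2 → g ∈ (traj m).Q) :
    |((traj t2).w f - (traj t1).w f) - ((traj t2).w g - (traj t1).w g)| ≤
      2 * max (p.wp * p.Linput) (p.wq * p.M) := by
  rw [htraj.w_sub_w h12.le hf, htraj.w_sub_w h12.le hg]
  obtain ⟨n, rfl⟩ := Nat.exists_eq_add_one_of_ne_zero (Nat.ne_zero_of_lt h12)
  have hn : t1 ≤ n := Nat.lt_succ_iff.mp h12
  have hend := htraj.abs_c_sub_c_succ_le (hf n hn n.lt_succ_self) (hg n hn n.lt_succ_self)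
  have hstart := (htraj.isBalanced t1).abs_sub_le (hf t1 le_rfl h12) (hg t1 le_rfl h12)
  rw [abs_le] at hend hstart ⊢
  constructor <;> linarith
end

section
/- Arrival transition preserves the VTC counter invariant: let S be a nonempty finite set, c : S → ℝ a family of real counters with max_{i∈S} c_i − min_{i∈S} c_i ≤ U, and let x ∈ ℝ satisfy x ≤ min_{i∈S} c_i + U. Let u ∉ S and extend c to S ∪ {u} by setting c_u = max(x, min_{i∈S} c_i). Then the extended family satisfies max_{i∈S∪{u}} c_i − min_{i∈S∪{u}} c_i ≤ U, and moreover min_{i∈S∪{u}} c_i = min_{i∈S} c_i. -/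
/-- **the arrival transition preserves the VTC counter
invariant.**  Let `S` be a nonempty finite set, `c : ι → ℝ` a family of real
counters with `max_{i∈S} c i − min_{i∈S} c i ≤ U`, and let `x ∈ ℝ` satisfy
`x ≤ min_{i∈S} c i + U` (the stale counter value of the arriving client).  Let
`u ∉ S` and extend `c` to `S ∪ {u}` by setting the counter of `u` to
`max x (min_{i∈S} c i)`.  Then the extended family satisfies
`max_{i∈S∪{u}} − min_{i∈S∪{u}} ≤ U`, and moreover
`min_{i∈S∪{u}} = min_{i∈S} c i`. -/
theorem arrival_preserves_invariant {ι : Type*} [DecidableEq ι]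
    (S : Finset ι) (hS : S.Nonempty) (c : ι → ℝ) (U x : ℝ)
    (hinv : S.sup' hS c - S.inf' hS c ≤ U)
    (hx : x ≤ S.inf' hS c + U)
    (u : ι) (hu : u ∉ S) :
    (insert u S).sup' (S.insert_nonempty u) (Function.update c u (max x (S.inf' hS c))) -
        (insert u S).inf' (S.insert_nonempty u) (Function.update c u (max x (S.inf' hS c))) ≤ U
    ∧ (insert u S).inf' (S.insert_nonempty u) (Function.update c u (max x (S.inf' hS c))) =
        S.inf' hS c := by
  have hupd : ∀ i ∈ S, Function.update c u (max x (S.inf' hS c)) i = c i := fun i hi =>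
    Function.update_of_ne (ne_of_mem_of_not_mem hi hu) _ _
  have hinf : (insert u S).inf' (S.insert_nonempty u)
      (Function.update c u (max x (S.inf' hS c))) = S.inf' hS c := by
    rw [Finset.inf'_insert hS, Function.update_self, Finset.inf'_congr hS rfl hupd]
    exact inf_eq_right.2 (le_max_right _ _)
  refine ⟨?_, hinf⟩
  rw [hinf, Finset.sup'_insert hS, Function.update_self, Finset.sup'_congr hS rfl hupd,
    sub_le_iff_le_add']
  obtain ⟨i, hi⟩ := id hS
  have hle : S.inf' hS c ≤ S.sup' hS c := (Finset.inf'_le c hi).trans (Finset.le_sup' c hi)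
  exact sup_le (max_le hx (by linarith)) (by linarith)
end
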